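/- arXiv:2207.14516 — 6 statements merged into one kernel-verified Lean document; each statement's English description precedes it below -/
import Mathlib

section
/- Let I ⊆ X be a closed subset and let M = ⊕_{μ∈I} M_μ be an I-graded 𝒜-module with E- and F-maps satisfying conditions (X1) and (X3). Then M is a torsion free 𝒜-module; in particular, the modules M_{δμ}, M_{{μ}} and M_{⟨μ⟩} are torsion free 𝒜-modules for all μ ∈ I. -/
/-! Common framework for "Quantum tilting modules over local rings" (Fiebig). -/

noncomputable section

open scoped DirectSum

/-- The ring `𝒵 = ℤ[v,v⁻¹]` of Laurent polynomials over `ℤ`. -/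
abbrev 𝒵 : Type := LaurentPolynomial ℤ

/-- Quantum integer `[n]_d` for `n : ℕ`. -/
def qintNat (d : ℕ) (n : ℕ) : 𝒵 :=
  ∑ i ∈ Finset.range n, LaurentPolynomial.T ((d : ℤ) * ((n : ℤ) - 1 - 2 * (i : ℤ)))

/-- Quantum integer `[n]_d = (v^{dn} - v^{-dn})/(v^d - v^{-d})` for `n : ℤ`. -/
def qint (d : ℕ) (n : ℤ) : 𝒵 :=
  if 0 ≤ n then qintNat d n.toNat else -qintNat d (-n).toNat

/-- Balanced quantum binomial coefficient `[n; r]_d` for natural `n`, via the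
quantum Pascal relation `[n+1;r+1] = v^{d(r+1)}[n;r+1] + v^{-d(n-r)}[n;r]`. -/
def qbinomNat (d : ℕ) : ℕ → ℕ → 𝒵
  | _, 0 => 1
  | 0, _ + 1 => 0
  | n + 1, r + 1 =>
      LaurentPolynomial.T ((d : ℤ) * ((r : ℤ) + 1)) * qbinomNat d n (r + 1) +
        LaurentPolynomial.T (-(d : ℤ) * ((n : ℤ) - (r : ℤ))) * qbinomNat d n r

/-- Balanced quantum binomial coefficient `[n; r]_d` for `n : ℤ`, using
`[-n; r] = (-1)^r [n + r - 1; r]`. -/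
def qbinom (d : ℕ) (n : ℤ) (r : ℕ) : 𝒵 :=
  if 0 ≤ n then qbinomNat d n.toNat r
  else (-1) ^ r * qbinomNat d ((r : ℤ) - 1 - n).toNat r

/-- The combinatorial data of a finite root system: the weight lattice `X`, the
(finite) set `Pi` of simple roots, the pairing `⟨·, α^∨⟩ : X → ℤ` with the coroots,
and the symmetrizing numbers `d_α ∈ {1,2,3}`. The simple roots are linearly
independent (field `free`), `⟨α, α^∨⟩ = 2`, and `(d_α ⟨α, β^∨⟩)` is symmetric. -/
structure RootSystemData where
  X : Type
  [addX : AddCommGroup X]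
  Pi : Type
  [finPi : Fintype Pi]
  root : Pi → X
  pair : Pi → (X →+ ℤ)
  d : Pi → ℕ
  pair_root_self : ∀ α, pair α (root α) = 2
  d_mem : ∀ α, d α = 1 ∨ d α = 2 ∨ d α = 3
  symm : ∀ α β, (d α : ℤ) * pair β (root α) = (d β : ℤ) * pair α (root β)
  free : ∀ f g : Pi → ℕ, (∑ α, f α • root α) = (∑ α, g α • root α) → f = g

attribute [instance] RootSystemData.addX RootSystemData.finPi

namespace QTilt

variable (R : RootSystemData)

/-- The standard order on the weight lattice: `μ ≤ λ` iff `λ - μ` is a sum of simple roots. -/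
def rle (μ lam : R.X) : Prop := ∃ f : R.Pi → ℕ, lam = μ + ∑ α, f α • R.root α

/-- A subset `I ⊆ X` is closed if `μ ∈ I` and `μ ≤ λ` imply `λ ∈ I`. -/
def RClosed (I : Set R.X) : Prop := ∀ μ ∈ I, ∀ lam, rle R μ lam → lam ∈ I

/-- A subset `S ⊆ X` is quasi-bounded if `{λ ∈ S | μ ≤ λ}` is finite for all `μ`. -/
def QuasiBdd (S : Set R.X) : Prop := ∀ μ : R.X, {lam ∈ S | rle R μ lam}.Finite

variable (A : Type) [CommRing A]

/-- An `X`-graded `A`-module `M = ⊕_μ M_μ` together with `A`-linear operators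
`E_{μ,α,n} : M_μ → M_{μ+nα}` and `F_{μ,α,n} : M_{μ+nα} → M_μ` (only the values for
`n > 0` are relevant). -/
structure GrObj where
  M : R.X → Type
  [addM : ∀ μ, AddCommGroup (M μ)]
  [modM : ∀ μ, Module A (M μ)]
  E : ∀ (μ : R.X) (α : R.Pi) (n : ℕ), M μ →ₗ[A] M (μ + n • R.root α)
  F : ∀ (μ : R.X) (α : R.Pi) (n : ℕ), M (μ + n • R.root α) →ₗ[A] M μ

attribute [instance] GrObj.addM GrObj.modM

variable {R A}

/-- Transport along an equality of weights. -/
def GrObj.cg (M : GrObj R A) {μ ν : R.X} (h : μ = ν) : M.M μ →ₗ[A] M.M ν := by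
  subst h; exact LinearMap.id

lemma wt_eq (R : RootSystemData) (μ : R.X) (α : R.Pi) {m n r : ℕ} (h : r ≤ min m n) :
    μ + n • R.root α + (m - r) • R.root α = μ + m • R.root α + (n - r) • R.root α := by
  rw [add_assoc, add_assoc, ← add_nsmul, ← add_nsmul]
  have hmn : n + (m - r) = m + (n - r) := by omega
  rw [hmn]

/-- `im F_μ ⊆ M_μ`, the sum of the images of all `F_{μ,α,n}` with `n > 0`. -/
def imF (M : GrObj R A) (μ : R.X) : Submodule A (M.M μ) :=
  ⨆ p : R.Pi × {n : ℕ // 0 < n}, LinearMap.range (M.F μ p.1 p.2)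

lemma mem_imF (M : GrObj R A) (μ : R.X) (α : R.Pi) {n : ℕ} (hn : 0 < n)
    (y : M.M (μ + n • R.root α)) : M.F μ α n y ∈ imF M μ :=
  Submodule.mem_iSup_of_mem (⟨α, ⟨n, hn⟩⟩ : R.Pi × {n : ℕ // 0 < n}) ⟨y, rfl⟩

/-- `M_{δμ} = ⊕_{α ∈ Π, n > 0} M_{μ+nα}` (a product, which agrees with the direct
sum for objects with quasi-bounded weights). -/
abbrev Delta (M : GrObj R A) (μ : R.X) : Type :=
  ∀ p : R.Pi × {n : ℕ // 0 < n}, M.M (μ + (p.2 : ℕ) • R.root p.1)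

/-- The column vector `E_μ : M_μ → M_{δμ}` with entries `E_{μ,α,n}`. -/
def Emap (M : GrObj R A) (μ : R.X) : M.M μ →ₗ[A] Delta M μ :=
  LinearMap.pi fun p => M.E μ p.1 (p.2 : ℕ)

/-- `M_{{μ}} = E_μ(im F_μ) ⊆ M_{δμ}`. -/
def Mcur (M : GrObj R A) (μ : R.X) : Submodule A (Delta M μ) :=
  (imF M μ).map (Emap M μ)

/-- `M_{⟨μ⟩} = E_μ(M_μ) ⊆ M_{δμ}`. -/
def Mang (M : GrObj R A) (μ : R.X) : Submodule A (Delta M μ) :=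
  LinearMap.range (Emap M μ)

/-- `M_{{μ},max}`: the preimage in `M_{δμ}` of the torsion part of `M_{δμ}/M_{{μ}}`. -/
def MmaxSet (M : GrObj R A) (μ : R.X) : Set (Delta M μ) :=
  {m | ∃ ξ : A, ξ ≠ 0 ∧ ξ • m ∈ Mcur M μ}

/-- `M` is supported on `I`, i.e. `M_μ = 0` for `μ ∉ I`. -/
def TrivOutside (I : Set R.X) (M : GrObj R A) : Prop :=
  ∀ μ, μ ∉ I → ∀ x : M.M μ, x = 0

/-- Condition (X1): the set of weights is quasi-bounded and each `M_μ` is a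
finitely generated `A`-module. -/
def IsX1 (M : GrObj R A) : Prop :=
  QuasiBdd R {μ | ∃ x : M.M μ, x ≠ 0} ∧ ∀ μ, Module.Finite A (M.M μ)

/-- Condition (X2): the quantum `sl₂`-type commutation relations between the
`E`- and `F`-operators. -/
def IsX2 [Algebra 𝒵 A] (I : Set R.X) (M : GrObj R A) : Prop :=
  (∀ μ ∈ I, ∀ (α β : R.Pi), α ≠ β → ∀ (m n : ℕ), 0 < m → 0 < n →
    ∀ w : M.M (μ + n • R.root β),
      M.E μ α m (M.F μ β n w) =
        M.F (μ + m • R.root α) β n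
          (M.cg (add_right_comm μ (n • R.root β) (m • R.root α))
            (M.E (μ + n • R.root β) α m w))) ∧
  (∀ μ ∈ I, ∀ (α : R.Pi) (m n : ℕ), 0 < m → 0 < n → ∀ w : M.M (μ + n • R.root α),
      M.E μ α m (M.F μ α n w) =
        ∑ r ∈ (Finset.range (min m n + 1)).attach,
          algebraMap 𝒵 A (qbinom (R.d α) (R.pair α μ + m + n) r.1) •
            M.F (μ + m • R.root α) α (n - r.1)
              (M.cg (wt_eq R μ α (Nat.lt_succ_iff.mp (Finset.mem_range.mp r.2)))
                (M.E (μ + n • R.root α) α (m - r.1) w)))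

/-- Condition (X3a): `E_μ` is injective on `im F_μ`. -/
def IsX3a (I : Set R.X) (M : GrObj R A) : Prop :=
  ∀ μ ∈ I, ∀ x ∈ imF M μ, Emap M μ x = 0 → x = 0

/-- Condition (X3b): `M_{⟨μ⟩}/M_{{μ}}` is a torsion `A`-module. -/
def IsX3b (I : Set R.X) (M : GrObj R A) : Prop :=
  ∀ μ ∈ I, ∀ x : M.M μ, ∃ ξ : A, ξ ≠ 0 ∧ ξ • Emap M μ x ∈ Mcur M μ

/-- Condition (X3c): `M_μ / im F_μ` is a free `A`-module. -/
def IsX3c (I : Set R.X) (M : GrObj R A) : Prop :=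
  ∀ μ ∈ I, Module.Free A (M.M μ ⧸ imF M μ)

/-- Condition (X3). -/
def IsX3 (I : Set R.X) (M : GrObj R A) : Prop :=
  IsX3a I M ∧ IsX3b I M ∧ IsX3c I M

/-- An object of the category `𝒳_{I,𝒜}`. -/
def IsXObj [Algebra 𝒵 A] (I : Set R.X) (M : GrObj R A) : Prop :=
  TrivOutside I M ∧ IsX1 M ∧ IsX2 I M ∧ IsX3 I M

/-- A morphism `M_{I'} → N_{I'}` in `𝒳_{I',𝒜}`: a family of `A`-linear maps in each
weight commuting with the `E`- and `F`-operators over `I'`. -/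
def IsHomOn (I' : Set R.X) (M N : GrObj R A) (f : ∀ μ, M.M μ →ₗ[A] N.M μ) : Prop :=
  (∀ μ ∈ I', ∀ (α : R.Pi) (n : ℕ), 0 < n → ∀ x : M.M μ,
      f (μ + n • R.root α) (M.E μ α n x) = N.E μ α n (f μ x)) ∧
  (∀ μ ∈ I', ∀ (α : R.Pi) (n : ℕ), 0 < n → ∀ y : M.M (μ + n • R.root α),
      f μ (M.F μ α n y) = N.F μ α n (f (μ + n • R.root α) y))

/-- An isomorphism `M_{I'} ≅ N_{I'}` in `𝒳_{I',𝒜}`. -/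
def IsIsoOn (I' : Set R.X) (M N : GrObj R A) (f : ∀ μ, M.M μ →ₗ[A] N.M μ) : Prop :=
  IsHomOn I' M N f ∧ ∀ μ ∈ I', Function.Bijective (f μ)

/-- `M ≅ N` in `𝒳_{I',𝒜}`. -/
def IsoOn (I' : Set R.X) (M N : GrObj R A) : Prop :=
  ∃ f : ∀ μ, M.M μ →ₗ[A] N.M μ, IsIsoOn I' M N f

/-- The induced map `f'_{δμ} : M_{δμ} → N_{δμ}` of a family of maps. -/
def dmap {M N : GrObj R A} (f : ∀ μ, M.M μ →ₗ[A] N.M μ) (μ : R.X) :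
    Delta M μ →ₗ[A] Delta N μ :=
  LinearMap.pi fun p => (f (μ + (p.2 : ℕ) • R.root p.1)).comp (LinearMap.proj p)

/-- `M` is a minimal object: `M_{{μ}} = M_{⟨μ⟩}` for all `μ ∈ I`. -/
def MinimalOn (I : Set R.X) (M : GrObj R A) : Prop :=
  ∀ μ ∈ I, Mcur M μ = Mang M μ

/-- `M` is a maximal object: `M_{⟨μ⟩} = M_{{μ},max}` for all `μ ∈ I`. -/
def MaximalOn (I : Set R.X) (M : GrObj R A) : Prop :=
  ∀ μ ∈ I, MmaxSet M μ = (Mang M μ : Set (Delta M μ))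

/-- A module is torsion free. -/
def TorsionFree (A : Type) [CommRing A] (V : Type) [AddCommGroup V] [Module A V] : Prop :=
  ∀ (a : A) (x : V), a • x = 0 → a = 0 ∨ x = 0

/-- The direct sum of two graded objects. -/
def prodObj (M N : GrObj R A) : GrObj R A where
  M := fun μ => M.M μ × N.M μ
  E := fun μ α n => (M.E μ α n).prodMap (N.E μ α n)
  F := fun μ α n => (M.F μ α n).prodMap (N.F μ α n)

/-- The direct sum of a family of graded objects. -/
def dSum (J : Type) (Mi : J → GrObj R A) : GrObj R A :=
  letI := Classical.decEq J
  { M := fun μ => ⨁ i, (Mi i).M μ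
    E := fun μ α n => DirectSum.toModule A J _ fun i =>
      (DirectSum.lof A J (fun j => (Mi j).M (μ + n • R.root α)) i).comp ((Mi i).E μ α n)
    F := fun μ α n => DirectSum.toModule A J _ fun i =>
      (DirectSum.lof A J (fun j => (Mi j).M μ) i).comp ((Mi i).F μ α n) }

/-- The underlying module `⊕_μ M_μ` of a graded object. -/
abbrev Total (M : GrObj R A) : Type := ⨁ μ, M.M μ

/-- The zero graded object predicate. -/
def AllZero (M : GrObj R A) : Prop := ∀ μ, ∀ x : M.M μ, x = 0

/-- `M` is an indecomposable object of `𝒳_{I,𝒜}`. -/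
def IndecOn [Algebra 𝒵 A] (I : Set R.X) (M : GrObj R A) : Prop :=
  (¬ AllZero M) ∧
  ∀ N N' : GrObj R A, IsXObj I N → IsXObj I N' → IsoOn I M (prodObj N N') →
    AllZero N ∨ AllZero N'

/-- `S` satisfies the defining properties of the minimal object `S_min(λ)`. -/
def IsSmin [Algebra 𝒵 A] (lam : R.X) (S : GrObj R A) : Prop :=
  IsXObj Set.univ S ∧ Nonempty (S.M lam ≃ₗ[A] A) ∧
    (∀ μ, (∃ x : S.M μ, x ≠ 0) → rle R μ lam) ∧
    IndecOn Set.univ S ∧ MinimalOn Set.univ S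

/-- `S` satisfies the defining properties of the maximal object `S_max(λ)`. -/
def IsSmax [Algebra 𝒵 A] (lam : R.X) (S : GrObj R A) : Prop :=
  IsXObj Set.univ S ∧ Nonempty (S.M lam ≃ₗ[A] A) ∧
    (∀ μ, (∃ x : S.M μ, x ≠ 0) → rle R μ lam) ∧
    IndecOn Set.univ S ∧ MaximalOn Set.univ S

/-- A symmetric contravariant form on `M`, given by its diagonal weight components
(the components between distinct weight spaces vanish). -/
def IsContraForm (I : Set R.X) (M : GrObj R A)
    (b : ∀ μ, M.M μ →ₗ[A] M.M μ →ₗ[A] A) : Prop :=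
  (∀ μ (x y : M.M μ), b μ x y = b μ y x) ∧
  (∀ μ ∈ I, ∀ (α : R.Pi) (n : ℕ), 0 < n →
    ∀ (x : M.M μ) (y : M.M (μ + n • R.root α)),
      b (μ + n • R.root α) (M.E μ α n x) y = b μ x (M.F μ α n y))

/-- Non-degeneracy of a family of forms on the weights in `I`:
each induced map `M_μ → Hom_A(M_μ, A)` is an isomorphism. -/
def NondegOn (I : Set R.X) {M : GrObj R A}
    (b : ∀ μ, M.M μ →ₗ[A] M.M μ →ₗ[A] A) : Prop :=
  ∀ μ ∈ I, Function.Bijective (b μ)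

/-- The radical of the family of forms vanishes on the weights in `I`. -/
def RadZeroOn (I : Set R.X) {M : GrObj R A}
    (b : ∀ μ, M.M μ →ₗ[A] M.M μ →ₗ[A] A) : Prop :=
  ∀ μ ∈ I, ∀ x : M.M μ, (∀ y, b μ x y = 0) → x = 0

/-- Base change of a graded object along `A → B`. -/
def GrObj.baseChange (B : Type) [CommRing B] [Algebra A B] (M : GrObj R A) : GrObj R B where
  M := fun μ => TensorProduct A B (M.M μ)
  E := fun μ α n => LinearMap.baseChange B (M.E μ α n)
  F := fun μ α n => LinearMap.baseChange B (M.F μ α n)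

/-- `𝒜` is generic (of quantum characteristic `0`): no nonzero quantum integer
vanishes in `𝒜`. -/
def IsGeneric (A : Type) [CommRing A] [Algebra 𝒵 A] : Prop :=
  ∀ (d : ℕ) (n : ℤ), 0 < d → n ≠ 0 → algebraMap 𝒵 A (qint d n) ≠ 0


lemma tf_aux (R : RootSystemData) (A : Type) [CommRing A] [IsDomain A]
    (I : Set R.X) (hI : RClosed R I) (M : GrObj R A)
    (htriv : TrivOutside I M) (h1 : IsX1 M) (h3 : IsX3 I M) (a : A) (ha : a ≠ 0) :
    ∀ (k : ℕ) (μ : R.X), {lam ∈ {μ | ∃ x : M.M μ, x ≠ 0} | rle R μ lam}.ncard = k →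
      ∀ x : M.M μ, a • x = 0 → x = 0 := by
  classical
  intro k
  induction k using Nat.strong_induction_on with
  | _ k ih =>
    intro μ hk x hax
    by_contra hx
    have hμ : μ ∈ I := by
      by_contra h
      exact hx (htriv μ h x)
    obtain ⟨h3a, -, h3c⟩ := h3
    have hxF : x ∈ imF M μ := by
      haveI := h3c μ hμ
      have h0 : a • (Submodule.Quotient.mk x : M.M μ ⧸ imF M μ) = 0 := by
        rw [← Submodule.Quotient.mk_smul, hax, Submodule.Quotient.mk_zero]
      rcases smul_eq_zero.mp h0 with h | h
      · exact absurd h ha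
      · exact (Submodule.Quotient.mk_eq_zero _).mp h
    apply hx
    apply h3a μ hμ x hxF
    funext p
    obtain ⟨α, n, hn⟩ := p
    change M.E μ α n x = 0
    refine ih _ ?_ (μ + n • R.root α) rfl _ (by rw [← map_smul, hax, map_zero])
    rw [← hk]
    apply Set.ncard_lt_ncard _ (h1.1 μ)
    have hsum : ∑ β, (Pi.single α n : R.Pi → ℕ) β • R.root β = n • R.root α := by
      rw [Finset.sum_eq_single α]
      · simp
      · intro b _ hb
        simp [hb]
      · simp
    refine ⟨?_, ?_⟩
    · rintro lam ⟨hl, f, hf⟩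
      refine ⟨hl, Pi.single α n + f, ?_⟩
      simp only [Pi.add_apply, add_smul, Finset.sum_add_distrib, hsum]
      rw [hf, add_assoc]
    · intro hsub
      have hm : μ ∈ {lam ∈ {μ | ∃ x : M.M μ, x ≠ 0} | rle R μ lam} :=
        ⟨⟨x, hx⟩, 0, by simp⟩
      obtain ⟨-, f, hf⟩ := hsub hm
      have hz : ∑ β, (Pi.single α n + f : R.Pi → ℕ) β • R.root β =
          ∑ β, (0 : R.Pi → ℕ) β • R.root β := by
        simp only [Pi.add_apply, add_smul, Finset.sum_add_distrib, hsum]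
        rw [add_assoc] at hf
        simpa using hf.symm
      have := congrFun (R.free _ _ hz) α
      simp at this
      omega

/-- an `I`-graded module with operators satisfying (X1) and (X3) is a
torsion free `𝒜`-module; in particular `M_{δμ}`, `M_{{μ}}` and `M_{⟨μ⟩}` are
torsion free for all `μ ∈ I`. -/
theorem statement0 (R : RootSystemData) (A : Type) [CommRing A] [IsDomain A] [IsNoetherianRing A] [Algebra 𝒵 A]
    (I : Set R.X) (hI : RClosed R I) (M : GrObj R A)
    (htriv : TrivOutside I M) (h1 : IsX1 M) (h3 : IsX3 I M) :
    (∀ μ, TorsionFree A (M.M μ)) ∧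
    (∀ μ ∈ I, TorsionFree A (Delta M μ)) ∧
    (∀ μ ∈ I, TorsionFree A ↥(Mcur M μ)) ∧
    (∀ μ ∈ I, TorsionFree A ↥(Mang M μ)) := by
  have key : ∀ μ, TorsionFree A (M.M μ) := by
    intro μ a x hax
    by_cases ha : a = 0
    · exact Or.inl ha
    · exact Or.inr (tf_aux R A I hI M htriv h1 h3 a ha _ μ rfl x hax)
  have keyD : ∀ μ, TorsionFree A (Delta M μ) := by
    intro μ a x hax
    by_cases ha : a = 0
    · exact Or.inl ha
    · right
      funext p
      exact (key _ a (x p) (congrFun hax p)).resolve_left ha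
  have keyS : ∀ μ (N : Submodule A (Delta M μ)), TorsionFree A N := by
    intro μ N a x hax
    refine (keyD μ a x.1 (congrArg Subtype.val hax)).imp id fun h => Subtype.ext h
  exact ⟨key, fun μ _ => keyD μ, fun μ _ => keyS μ _, fun μ _ => keyS μ _⟩

end QTilt

end
end

section
/- Let I ⊆ X be a closed subset and let M = ⊕_{μ∈I} M_μ be an I-graded 𝒜-module with E- and F-maps for which condition (X3a) holds. Then for any μ ∈ I the following are equivalent: (1) M_μ = ker E_μ ⊕ im F_μ (internal direct sum decomposition of M_μ); (2) M_{{μ}} = M_{⟨μ⟩}. -/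
/-! Common framework for "Quantum tilting modules over local rings" (Fiebig). -/

noncomputable section

open scoped DirectSum

namespace QTilt

variable (R : RootSystemData)

variable (A : Type) [CommRing A]

variable {R A}

/-- under (X3a), for `μ ∈ I` one has
`M_μ = ker E_μ ⊕ im F_μ` if and only if `M_{{μ}} = M_{⟨μ⟩}`. -/
theorem statement1 (R : RootSystemData) (A : Type) [CommRing A] [IsDomain A] [IsNoetherianRing A] [Algebra 𝒵 A]
    (I : Set R.X) (hI : RClosed R I) (M : GrObj R A)
    (htriv : TrivOutside I M) (h3a : IsX3a I M) (μ : R.X) (hμ : μ ∈ I) :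
    IsCompl (LinearMap.ker (Emap M μ)) (imF M μ) ↔ Mcur M μ = Mang M μ := by
  have hsup : Codisjoint (LinearMap.ker (Emap M μ)) (imF M μ) ↔ Mcur M μ = Mang M μ := by
    unfold Mcur Mang
    rw [codisjoint_iff, sup_comm, LinearMap.range_eq_map]
    constructor
    · intro h
      rw [← h, Submodule.map_sup]
      simp [Submodule.map_le_iff_le_comap, (LinearMap.le_ker_iff_map).1 le_rfl]
    · intro h
      rw [← Submodule.comap_map_eq, h, Submodule.comap_map_eq]
      simp
  have hdis : Disjoint (LinearMap.ker (Emap M μ)) (imF M μ) := by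
    rw [Submodule.disjoint_def]
    intro x hx hx'
    exact h3a μ hμ x hx' hx
  exact ⟨fun h => hsup.1 h.codisjoint, fun h => ⟨hdis, hsup.2 h⟩⟩

end QTilt

end
end

section
/- Let I ⊆ X be a closed subset and let M = ⊕_{μ∈I} M_μ be an I-graded 𝒜-module with E- and F-maps satisfying condition (X1), and let 𝒦 be the quotient field of 𝒜 (write N_𝒦 := N ⊗_𝒜 𝒦). Then condition (X3) is equivalent to the conjunction of: (1) M is a torsion free 𝒜-module; (2) for all μ ∈ I, (M_μ)_𝒦 = (ker E_μ)_𝒦 ⊕ (im F_μ)_𝒦; (3) M_μ/im F_μ is a free 𝒜-module for all μ ∈ I. In particular, if 𝒜 = 𝒦 is a field, then condition (X3) is equivalent to M_μ = ker E_μ ⊕ im F_μ for all μ ∈ I. -/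
/-! Common framework for "Quantum tilting modules over local rings" (Fiebig). -/

noncomputable section

open scoped DirectSum

namespace QTilt

variable (R : RootSystemData)

variable (A : Type) [CommRing A]

variable {R A}

theorem loc_compl {A V : Type} [CommRing A] [IsDomain A] [AddCommGroup V] [Module A V]
    (K F : Submodule A V) :
    IsCompl (K.localized (nonZeroDivisors A)) (F.localized (nonZeroDivisors A)) ↔
      (∀ x ∈ K, x ∈ F → ∃ s : A, s ≠ 0 ∧ s • x = 0) ∧
      (∀ x : V, ∃ s : A, s ≠ 0 ∧ ∃ k ∈ K, ∃ f ∈ F, s • x = k + f) := by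
  have hsup : K.localized (nonZeroDivisors A) ⊔ F.localized (nonZeroDivisors A) =
      (K ⊔ F).localized (nonZeroDivisors A) :=
    ((Submodule.localized'gi (Localization (nonZeroDivisors A)) (nonZeroDivisors A)
      (LocalizedModule.mkLinearMap (nonZeroDivisors A) V)).gc.l_sup).symm
  rw [isCompl_iff, disjoint_iff, codisjoint_iff, hsup, ← Submodule.localized'_inf]
  refine and_congr ?_ ?_
  · constructor
    · intro h x hK hF
      have : LocalizedModule.mkLinearMap (nonZeroDivisors A) V x ∈
          (K ⊓ F).localized (nonZeroDivisors A) := ⟨x, ⟨hK, hF⟩, 1, by simp⟩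
      rw [Submodule.localized, h, Submodule.mem_bot, IsLocalizedModule.eq_zero_iff (nonZeroDivisors A)] at this
      obtain ⟨s, hs⟩ := this
      exact ⟨s, nonZeroDivisors.coe_ne_zero s, hs⟩
    · intro h
      rw [eq_bot_iff]
      rintro _ ⟨m, ⟨hK, hF⟩, t, rfl⟩
      obtain ⟨s, hs, hsm⟩ := h m hK hF
      rw [Submodule.mem_bot, IsLocalizedModule.mk'_eq_zero']
      exact ⟨⟨s, mem_nonZeroDivisors_of_ne_zero hs⟩, hsm⟩
  · constructor
    · intro h x
      have : LocalizedModule.mkLinearMap (nonZeroDivisors A) V x ∈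
          (K ⊔ F).localized (nonZeroDivisors A) := by rw [h]; trivial
      obtain ⟨m, hm, t, e⟩ := this
      rw [← IsLocalizedModule.mk'_one (nonZeroDivisors A),
        IsLocalizedModule.mk'_eq_mk'_iff] at e
      obtain ⟨u, hu⟩ := e
      have hmem : (u : A) • (t : A) • x ∈ K ⊔ F := by
        have h2 : (u : A) • (t : A) • x = (u : A) • m := by
          simpa [Submonoid.smul_def] using hu
        rw [h2]; exact Submodule.smul_mem _ _ hm
      obtain ⟨k, hk, f, hf, e⟩ := Submodule.mem_sup.1 hmem
      exact ⟨u * t, mul_ne_zero (nonZeroDivisors.coe_ne_zero u) (nonZeroDivisors.coe_ne_zero t),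
        k, hk, f, hf, by rw [mul_smul, e]⟩
    · intro h
      rw [eq_top_iff]
      rintro y -
      obtain ⟨⟨x, t⟩, rfl⟩ := IsLocalizedModule.mk'_surjective (nonZeroDivisors A)
        (LocalizedModule.mkLinearMap (nonZeroDivisors A) V) y
      obtain ⟨s, hs, k, hk, f, hf, e⟩ := h x
      refine ⟨s • x, e ▸ Submodule.add_mem_sup hk hf,
        ⟨s, mem_nonZeroDivisors_of_ne_zero hs⟩ * t, ?_⟩
      exact IsLocalizedModule.mk'_cancel_left _ _
        (⟨s, mem_nonZeroDivisors_of_ne_zero hs⟩ : nonZeroDivisors A) t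

theorem torsionFree_of_X3 {R : RootSystemData} {A : Type} [CommRing A] [IsDomain A]
    {I : Set R.X} {M : GrObj R A} (htriv : TrivOutside I M) (h1 : IsX1 M)
    (ha : IsX3a I M) (hc : IsX3c I M) : ∀ μ, TorsionFree A (M.M μ) := by
  classical
  have key : ∀ (n : ℕ) (μ : R.X),
      {lam ∈ {μ | ∃ x : M.M μ, x ≠ 0} | rle R μ lam}.ncard = n → TorsionFree A (M.M μ) := by
    intro n
    induction n using Nat.strong_induction_on with
    | _ n ih =>
    intro μ hn a x hax
    by_contra hcon
    push Not at hcon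
    obtain ⟨ha0, hx0⟩ := hcon
    have hμ : μ ∈ I := by
      by_contra h
      exact hx0 (htriv μ h x)
    apply hx0
    apply ha μ hμ x
    · have := hc μ hμ
      have h0 : a • (Submodule.Quotient.mk x : M.M μ ⧸ imF M μ) = 0 := by
        rw [← Submodule.Quotient.mk_smul, hax, Submodule.Quotient.mk_zero]
      rcases smul_eq_zero.1 h0 with h | h
      · exact absurd h ha0
      · exact (Submodule.Quotient.mk_eq_zero _).1 h
    · funext p
      obtain ⟨α, m, hm⟩ := p
      have htf : TorsionFree A (M.M (μ + m • R.root α)) := by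
        refine ih _ ?_ _ rfl
        rw [← hn]
        refine Set.ncard_lt_ncard ⟨?_, ?_⟩ (h1.1 μ)
        · rintro lam ⟨hl, f, hf⟩
          refine ⟨hl, f + Pi.single α m, ?_⟩
          rw [hf]
          simp [add_smul, Finset.sum_add_distrib, Pi.single_apply, ite_smul]
          abel
        · intro hsub
          have hmem := hsub (show μ ∈ {lam ∈ {μ | ∃ x : M.M μ, x ≠ 0} | rle R μ lam} from
            ⟨⟨x, hx0⟩, 0, by simp⟩)
          obtain ⟨-, f, hf⟩ := hmem
          have h2 := R.free (f + Pi.single α m) 0 (by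
            simp [add_smul, Finset.sum_add_distrib, Pi.single_apply, ite_smul]
            rw [add_assoc, left_eq_add] at hf
            rw [add_comm]; exact hf)
          have := congrFun h2 α
          simp at this
          omega
      have h3 : a • M.E μ α m x = 0 := by rw [← map_smul, hax, map_zero]
      exact (htf a _ h3).resolve_left ha0
  intro μ
  exact key _ μ rfl

/-- under (X1), condition (X3) is equivalent to: `M` is torsion free,
`(M_μ)_𝒦 = (ker E_μ)_𝒦 ⊕ (im F_μ)_𝒦` for all `μ ∈ I` (where `𝒦` is the quotient
field of `𝒜`), and `M_μ/im F_μ` is free for all `μ ∈ I`. If `𝒜` is a field then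
(X3) is equivalent to `M_μ = ker E_μ ⊕ im F_μ` for all `μ ∈ I`. -/
theorem statement2 (R : RootSystemData) (A : Type) [CommRing A] [IsDomain A] [IsNoetherianRing A] [Algebra 𝒵 A]
    (I : Set R.X) (hI : RClosed R I) (M : GrObj R A)
    (htriv : TrivOutside I M) (h1 : IsX1 M) :
    (IsX3 I M ↔
      ((∀ μ, TorsionFree A (M.M μ)) ∧
       (∀ μ ∈ I, IsCompl
          ((LinearMap.ker (Emap M μ)).localized (nonZeroDivisors A))
          ((imF M μ).localized (nonZeroDivisors A))) ∧
       (∀ μ ∈ I, Module.Free A (M.M μ ⧸ imF M μ)))) ∧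
    (IsField A →
      (IsX3 I M ↔ ∀ μ ∈ I, IsCompl (LinearMap.ker (Emap M μ)) (imF M μ))) := by
  have dec : ∀ μ (x : M.M μ) (ξ : A), ξ • Emap M μ x ∈ Mcur M μ →
      ∃ k ∈ LinearMap.ker (Emap M μ), ∃ f ∈ imF M μ, ξ • x = k + f := by
    rintro μ x ξ ⟨f, hf, e⟩
    exact ⟨ξ • x - f, by rw [LinearMap.mem_ker, map_sub, map_smul, e, sub_self], f, hf, by abel⟩
  have dec' : ∀ μ (x : M.M μ) (ξ : A), (∃ k ∈ LinearMap.ker (Emap M μ), ∃ f ∈ imF M μ,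
      ξ • x = k + f) → ξ • Emap M μ x ∈ Mcur M μ := by
    rintro μ x ξ ⟨k, hk, f, hf, e⟩
    refine ⟨f, hf, ?_⟩
    rw [← map_smul, e, map_add, LinearMap.mem_ker.1 hk, zero_add]
  refine ⟨⟨?_, ?_⟩, ?_⟩
  · rintro ⟨ha, hb, hc⟩
    refine ⟨torsionFree_of_X3 htriv h1 ha hc, fun μ hμ => ?_, hc⟩
    rw [loc_compl]
    refine ⟨fun x hK hF => ⟨1, one_ne_zero, ?_⟩, fun x => ?_⟩
    · rw [one_smul]; exact ha μ hμ x hF hK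
    · obtain ⟨ξ, h0, h⟩ := hb μ hμ x
      exact ⟨ξ, h0, dec μ x ξ h⟩
  · rintro ⟨ht, hcompl, hc⟩
    refine ⟨fun μ hμ x hF hK => ?_, fun μ hμ x => ?_, hc⟩
    · obtain ⟨s, hs, h⟩ := ((loc_compl _ _).1 (hcompl μ hμ)).1 x hK hF
      exact (ht μ s x h).resolve_left hs
    · obtain ⟨s, hs, h⟩ := ((loc_compl _ _).1 (hcompl μ hμ)).2 x
      exact ⟨s, hs, dec' μ x s h⟩
  · intro hA
    constructor
    · rintro ⟨ha, hb, hc⟩ μ hμ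
      rw [isCompl_iff, Submodule.disjoint_def, codisjoint_iff, eq_top_iff]
      refine ⟨fun x hK hF => ha μ hμ x hF hK, fun x _ => ?_⟩
      obtain ⟨ξ, h0, h⟩ := hb μ hμ x
      obtain ⟨k, hk, f, hf, e⟩ := dec μ x ξ h
      obtain ⟨η, hη⟩ := hA.mul_inv_cancel h0
      have : x = η • (k + f) := by rw [← e, smul_smul, mul_comm, hη, one_smul]
      rw [this]
      exact Submodule.smul_mem _ _ (Submodule.add_mem_sup hk hf)
    · intro h
      refine ⟨fun μ hμ x hF hK => ?_, fun μ hμ x => ⟨1, one_ne_zero, ?_⟩, fun μ hμ => ?_⟩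
      · exact (Submodule.disjoint_def.1 (h μ hμ).disjoint) x hK hF
      · apply dec'
        have hx : x ∈ LinearMap.ker (Emap M μ) ⊔ imF M μ := by
          rw [(h μ hμ).sup_eq_top]; trivial
        obtain ⟨k, hk, f, hf, e⟩ := Submodule.mem_sup.1 hx
        exact ⟨k, hk, f, hf, by rw [one_smul, e]⟩
      · letI := hA.toField
        exact Module.Free.of_divisionRing A _

end QTilt

end
end

section
/- Let 𝒜 → ℬ be a flat homomorphism of unital Noetherian 𝒵-domains, let I ⊆ X be a closed subset, and let M be an object of 𝒳_{I,𝒜}. Then the base change M_ℬ = ⊕_{μ∈I} M_μ ⊗_𝒜 ℬ, equipped with the induced maps E_{μ,α,n} ⊗ id_ℬ and F_{μ,α,n} ⊗ id_ℬ, is an object of 𝒳_{I,ℬ}. -/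
/-! Common framework for "Quantum tilting modules over local rings" (Fiebig). -/

noncomputable section

open scoped DirectSum

namespace QTilt

variable (R : RootSystemData)

variable (A : Type) [CommRing A]

variable {R A}

section BC

variable {R : RootSystemData} {A : Type} [CommRing A] (B : Type) [CommRing B] [Algebra A B]

/-- Pure tensors in the base change. -/
def tm (M : GrObj R A) {μ : R.X} (b : B) (x : M.M μ) : (M.baseChange B).M μ :=
  (TensorProduct.tmul A b x : TensorProduct A B (M.M μ))

variable (M : GrObj R A)

lemma bc_ind {μ : R.X} {P : (M.baseChange B).M μ → Prop} (h0 : P 0)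
    (ht : ∀ b x, P (tm B M b x)) (ha : ∀ x y, P x → P y → P (x + y)) : ∀ w, P w :=
  fun w => TensorProduct.induction_on (motive := P) w h0 ht ha

lemma tm_E (μ : R.X) (α : R.Pi) (n : ℕ) (b : B) (x : M.M μ) :
    (M.baseChange B).E μ α n (tm B M b x) = tm B M b (M.E μ α n x) := rfl

lemma tm_F (μ : R.X) (α : R.Pi) (n : ℕ) (b : B) (x : M.M (μ + n • R.root α)) :
    (M.baseChange B).F μ α n (tm B M b x) = tm B M b (M.F μ α n x) := rfl

lemma tm_cg {μ ν : R.X} (h : μ = ν) (b : B) (x : M.M μ) :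
    (M.baseChange B).cg h (tm B M b x) = tm B M b (M.cg h x) := by
  subst h; rfl

lemma tm_add {μ : R.X} (b : B) (x y : M.M μ) :
    tm B M b (x + y) = tm B M b x + tm B M b y := TensorProduct.tmul_add _ _ _

lemma tm_zero {μ : R.X} (b : B) : tm B M b (0 : M.M μ) = 0 := TensorProduct.tmul_zero _ _

lemma tm_smul {μ : R.X} (b : B) (a : A) (x : M.M μ) :
    tm B M b (a • x) = algebraMap A B a • tm B M b x := by
  change (TensorProduct.tmul A b (a • x) : TensorProduct A B (M.M μ)) =
    algebraMap A B a • (TensorProduct.tmul A b x : TensorProduct A B (M.M μ))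
  rw [algebraMap_smul, TensorProduct.tmul_smul]

lemma smul_tm {μ : R.X} (b c : B) (x : M.M μ) :
    c • tm B M b x = tm B M (c * b) x := rfl

lemma tm_sum {μ : R.X} (b : B) {ι : Type} (s : Finset ι) (f : ι → M.M μ) :
    tm B M b (∑ i ∈ s, f i) = ∑ i ∈ s, tm B M b (f i) :=
  map_sum (AddMonoidHom.mk' (fun x => tm B M b x) (tm_add B M b)) f s

lemma tm_mem_imF {μ : R.X} (b : B) (x : M.M μ) (hx : x ∈ imF M μ) :
    tm B M b x ∈ imF (M.baseChange B) μ := by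
  unfold imF at hx
  induction hx using Submodule.iSup_induction' with
  | mem p x hx =>
    obtain ⟨y, rfl⟩ := hx
    rw [← tm_F]
    exact mem_imF _ _ _ p.2.2 _
  | zero => rw [tm_zero]; exact zero_mem _
  | add x y _ _ hx hy => rw [tm_add]; exact add_mem hx hy

/-- The base change of the inclusion of `imF`. -/
def incl (μ : R.X) : TensorProduct A B (imF M μ) →ₗ[B] (M.baseChange B).M μ :=
  LinearMap.baseChange B (imF M μ).subtype

lemma imF_bc (μ : R.X) : imF (M.baseChange B) μ = LinearMap.range (incl B M μ) := by
  apply le_antisymm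
  · refine iSup_le fun p => ?_
    rintro _ ⟨y, rfl⟩
    revert y
    apply bc_ind
    · rw [map_zero]; exact zero_mem _
    · intro b x
      rw [tm_F]
      exact ⟨TensorProduct.tmul A b ⟨_, mem_imF M μ p.1 p.2.2 x⟩, rfl⟩
    · intro x y hx hy
      rw [map_add]; exact add_mem hx hy
  · rintro _ ⟨y, rfl⟩
    induction y using TensorProduct.induction_on with
    | zero => rw [map_zero]; exact zero_mem _
    | tmul b x => exact tm_mem_imF B M b x.1 x.2
    | add x y hx hy => rw [map_add]; exact add_mem hx hy

lemma bc_zero {μ : R.X} (h : ∀ x : M.M μ, x = 0) : ∀ x : (M.baseChange B).M μ, x = 0 := by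
  apply bc_ind
  · rfl
  · intro b x; rw [h x, tm_zero]
  · intro x y hx hy; rw [hx, hy, add_zero]

lemma tm_Emap (μ : R.X) (b : B) (x y : M.M μ) (h : Emap M μ x = Emap M μ y) :
    Emap (M.baseChange B) μ (tm B M b x) = Emap (M.baseChange B) μ (tm B M b y) := by
  funext p
  change (M.baseChange B).E μ p.1 p.2 (tm B M b x) = (M.baseChange B).E μ p.1 p.2 (tm B M b y)
  rw [tm_E, tm_E]
  congr 1
  exact congrFun h p

lemma wt_inj (μ : R.X) : Function.Injective
    (fun p : R.Pi × {n : ℕ // 0 < n} => μ + (p.2 : ℕ) • R.root p.1) := by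
  classical
  rintro ⟨α, n, hn⟩ ⟨β, m, hm⟩ h
  have h' : n • R.root α = m • R.root β := add_left_cancel h
  have := R.free (Pi.single α n) (Pi.single β m) (by
    simpa [Pi.single_apply, ite_smul] using h')
  have h1 := congrFun this α
  have h2 : α = β := by
    by_contra hne
    simp [Pi.single_apply, hne] at h1
    omega
  subst h2
  simp at h1
  subst h1
  rfl

lemma supp_finite (hM : IsX1 M) (μ : R.X) :
    {p : R.Pi × {n : ℕ // 0 < n} | ∃ x : M.M (μ + (p.2 : ℕ) • R.root p.1), x ≠ 0}.Finite := by
  classical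
  refine ((hM.1 μ).preimage (wt_inj μ).injOn).subset ?_
  intro p hp
  exact ⟨hp, Pi.single p.1 p.2, by simp [Pi.single_apply, ite_smul]⟩

lemma bc_X3a [Module.Flat A B] (hM : IsX1 M) (μ : R.X)
    (h : ∀ x ∈ imF M μ, Emap M μ x = 0 → x = 0) :
    ∀ x ∈ imF (M.baseChange B) μ, Emap (M.baseChange B) μ x = 0 → x = 0 := by
  classical
  set S := {p : R.Pi × {n : ℕ // 0 < n} | ∃ x : M.M (μ + (p.2 : ℕ) • R.root p.1), x ≠ 0} with hS
  haveI : Fintype S := (supp_finite M hM μ).fintype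
  let e : imF M μ →ₗ[A] (∀ p : S, M.M (μ + (p.1.2 : ℕ) • R.root p.1.1)) :=
    LinearMap.pi fun p => (M.E μ p.1.1 p.1.2).comp (imF M μ).subtype
  have he : Function.Injective e := by
    rw [← LinearMap.ker_eq_bot, LinearMap.ker_eq_bot']
    intro x hx
    apply Subtype.ext
    apply h _ x.2
    funext p
    by_cases hp : p ∈ S
    · exact congrFun hx ⟨p, hp⟩
    · by_contra hne
      exact hp ⟨_, hne⟩
  have he' : Function.Injective (LinearMap.lTensor B e) :=
    Module.Flat.lTensor_preserves_injective_linearMap e he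
  intro x hx hEx
  rw [imF_bc] at hx
  obtain ⟨y, rfl⟩ := hx
  have key : ∀ (y : TensorProduct A B (imF M μ)) (p : S),
      TensorProduct.piRight A A B (fun p : S => M.M (μ + (p.1.2 : ℕ) • R.root p.1.1))
        (LinearMap.lTensor B e y) p = Emap (M.baseChange B) μ (incl B M μ y) p.1 := by
    intro y p
    induction y using TensorProduct.induction_on with
    | zero => simp only [map_zero]; rfl
    | tmul b x =>
      simp only [LinearMap.lTensor_tmul, TensorProduct.piRight_apply, TensorProduct.piRightHom_tmul]
      rfl
    | add x y hx hy =>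
      simp only [map_add, Pi.add_apply, hx, hy]
      rfl
  have hy : y = 0 := by
    apply he'
    rw [map_zero]
    apply (TensorProduct.piRight A A B
      (fun p : S => M.M (μ + (p.1.2 : ℕ) • R.root p.1.1))).injective
    rw [map_zero]
    funext p
    rw [key, hEx]
    rfl
  rw [hy, map_zero]

lemma bc_X3b (hinj : Function.Injective (algebraMap A B)) [IsDomain B] (μ : R.X)
    (h : ∀ x : M.M μ, ∃ ξ : A, ξ ≠ 0 ∧ ξ • Emap M μ x ∈ Mcur M μ) :
    ∀ x : (M.baseChange B).M μ, ∃ ξ : B, ξ ≠ 0 ∧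
      ξ • Emap (M.baseChange B) μ x ∈ Mcur (M.baseChange B) μ := by
  apply bc_ind
  · exact ⟨1, one_ne_zero, by rw [map_zero, smul_zero]; exact zero_mem _⟩
  · intro b x
    obtain ⟨ξ, h0, y, hy, hyx⟩ := h x
    refine ⟨algebraMap A B ξ, fun h' => h0 (hinj (by rw [h', map_zero])), ?_⟩
    rw [← map_smul, ← tm_smul]
    refine ⟨tm B M b y, tm_mem_imF B M b y hy, ?_⟩
    apply tm_Emap
    rw [hyx, map_smul]
  · rintro x y ⟨ξ, h1, hx⟩ ⟨η, h2, hy⟩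
    refine ⟨ξ * η, mul_ne_zero h1 h2, ?_⟩
    rw [map_add, smul_add]
    refine add_mem ?_ ?_
    · rw [mul_comm, mul_smul]; exact Submodule.smul_mem _ _ hx
    · rw [mul_smul]; exact Submodule.smul_mem _ _ hy

lemma bc_X3c (μ : R.X) (h : Module.Free A (M.M μ ⧸ imF M μ)) :
    Module.Free B ((M.baseChange B).M μ ⧸ imF (M.baseChange B) μ) := by
  let q : (M.baseChange B).M μ →ₗ[B] TensorProduct A B (M.M μ ⧸ imF M μ) :=
    LinearMap.baseChange B (imF M μ).mkQ
  have hq : Function.Surjective q :=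
    LinearMap.lTensor_surjective B (Submodule.mkQ_surjective (imF M μ))
  have hex := lTensor_exact B (LinearMap.exact_subtype_mkQ (imF M μ))
    (Submodule.mkQ_surjective (imF M μ))
  have hker : LinearMap.ker q = imF (M.baseChange B) μ := by
    rw [imF_bc]
    ext x
    exact hex x
  rw [← hker]
  exact Module.Free.of_equiv (q.quotKerEquivOfSurjective hq).symm

lemma bc_X2 [Algebra 𝒵 A] [Algebra 𝒵 B] [IsScalarTower 𝒵 A B] (I : Set R.X)
    (h : IsX2 I M) : IsX2 I (M.baseChange B) := by
  constructor
  · intro μ hμ α β hab m n hm hn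
    apply bc_ind
    · simp only [map_zero]
    · intro b x
      rw [tm_F, tm_E, tm_E, tm_cg, tm_F, h.1 μ hμ α β hab m n hm hn x]
    · intro x y hx hy
      simp only [map_add, hx, hy]
  · intro μ hμ α m n hm hn
    apply bc_ind
    · simp only [map_zero, smul_zero, Finset.sum_const_zero]
    · intro b x
      rw [tm_F, tm_E, h.2 μ hμ α m n hm hn x, tm_sum]
      refine Finset.sum_congr rfl fun r _ => ?_
      rw [tm_smul, tm_E, tm_cg, tm_F, ← IsScalarTower.algebraMap_apply]
    · intro x y hx hy
      simp only [map_add, hx, hy, smul_add, Finset.sum_add_distrib]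

end BC

/-- flat base change `𝒜 → ℬ` of an object of `𝒳_{I,𝒜}` yields an
object of `𝒳_{I,ℬ}`. -/
theorem statement3 (R : RootSystemData) (A B : Type)
    [CommRing A] [IsDomain A] [IsNoetherianRing A] [Algebra 𝒵 A]
    [CommRing B] [IsDomain B] [IsNoetherianRing B] [Algebra 𝒵 B]
    [Algebra A B] [IsScalarTower 𝒵 A B] [Module.Flat A B]
    (I : Set R.X) (hI : RClosed R I) (M : GrObj R A) (hM : IsXObj I M) :
    IsXObj I (M.baseChange B) := by
  obtain ⟨h0, h1, h2, h3a, h3b, h3c⟩ := hM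
  have hinj : Function.Injective (algebraMap A B) := FaithfulSMul.algebraMap_injective A B
  refine ⟨fun μ hμ => bc_zero B M (h0 μ hμ), ⟨?_, ?_⟩, bc_X2 B M I h2,
    fun μ hμ => bc_X3a B M h1 μ (h3a μ hμ), fun μ hμ => bc_X3b B M hinj μ (h3b μ hμ),
    fun μ hμ => bc_X3c B M μ (h3c μ hμ)⟩
  · intro μ
    refine (h1.1 μ).subset ?_
    rintro lam ⟨⟨x, hx⟩, hle⟩
    refine ⟨?_, hle⟩
    by_contra hne
    simp only [Set.mem_setOf_eq, not_exists, not_not] at hne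
    exact hx (bc_zero B M hne x)
  · intro μ
    haveI := h1.2 μ
    exact (inferInstance : Module.Finite B (TensorProduct A B (M.M μ)))

end QTilt

end
end

section
/- Let 𝒜 be a commutative ring, and let S and T be 𝒜-modules with T projective. Let F : S → T and E : T → S be 𝒜-linear homomorphisms, and let b_S : S × S → 𝒜 and b_T : T × T → 𝒜 be symmetric bilinear forms that are non-degenerate, i.e. the induced maps S → Hom_𝒜(S, 𝒜) and T → Hom_𝒜(T, 𝒜) are isomorphisms, and suppose b_T(F(s), t) = b_S(s, E(t)) for all s ∈ S and t ∈ T. If the inclusion F(S) ⊆ T splits (i.e. F(S) is a direct summand of T), then the inclusion E(T) ⊆ S splits as well. -/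
/-! Common framework for "Quantum tilting modules over local rings" (Fiebig). -/

noncomputable section

open scoped DirectSum

namespace QTilt

variable (R : RootSystemData)

variable (A : Type) [CommRing A]

variable {R A}

/-- if `T` is projective, `b_S`, `b_T` are non-degenerate symmetric
bilinear forms with `b_T(F s, t) = b_S(s, E t)`, and `F(S) ⊆ T` splits, then
`E(T) ⊆ S` splits. -/
theorem statement15 (A : Type) [CommRing A] (S T : Type)
    [AddCommGroup S] [AddCommGroup T] [Module A S] [Module A T]
    [Module.Projective A T]
    (F : S →ₗ[A] T) (E : T →ₗ[A] S)
    (bS : S →ₗ[A] S →ₗ[A] A) (bT : T →ₗ[A] T →ₗ[A] A)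
    (hbSsymm : ∀ x y, bS x y = bS y x) (hbTsymm : ∀ x y, bT x y = bT y x)
    (hbS : Function.Bijective ⇑bS) (hbT : Function.Bijective ⇑bT)
    (hadj : ∀ (s : S) (t : T), bT (F s) t = bS s (E t))
    (hsplit : ∃ C : Submodule A T, IsCompl (LinearMap.range F) C) :
    ∃ C : Submodule A S, IsCompl (LinearMap.range E) C := by
  obtain ⟨C, hC⟩ := hsplit
  obtain ⟨p, hp⟩ : ∃ p : T →ₗ[A] LinearMap.range F, ∀ x : LinearMap.range F, p x = x :=
    ⟨Submodule.projectionOnto _ C hC, fun x => Submodule.projectionOnto_apply_left hC x⟩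
  obtain ⟨G, hG⟩ := Module.projective_lifting_property F.rangeRestrict p
    F.surjective_rangeRestrict
  have hFGF : ∀ s, F (G (F s)) = F s := fun s => by
    have h1 := congrArg Subtype.val (LinearMap.congr_fun hG (F s))
    have h2 := congrArg Subtype.val (hp ⟨F s, s, rfl⟩)
    exact h1.trans h2
  let e := LinearEquiv.ofBijective bT hbT
  let H : S →ₗ[A] T := e.symm.toLinearMap ∘ₗ (LinearMap.lcomp A A G) ∘ₗ bS
  have hH : ∀ s t, bT (H s) t = bS s (G t) := fun s t => by
    have h : e (H s) = LinearMap.lcomp A A G (bS s) := e.apply_symm_apply _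
    exact LinearMap.congr_fun h t
  have hEHE : ∀ t, E (H (E t)) = E t := fun t => by
    apply hbS.1
    ext s
    rw [hbSsymm, ← hadj, hbTsymm, hH, hbSsymm, ← hadj, hFGF, hadj, hbSsymm]
  refine ⟨LinearMap.ker (E ∘ₗ H), ?_⟩
  rw [isCompl_iff, Submodule.disjoint_def, codisjoint_iff, eq_top_iff]
  constructor
  · rintro _ ⟨t, rfl⟩ h
    rw [LinearMap.mem_ker, LinearMap.comp_apply, hEHE] at h
    exact h
  · intro s _
    refine Submodule.mem_sup.2 ⟨E (H s), ⟨_, rfl⟩, s - E (H s), ?_, by abel⟩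
    rw [LinearMap.mem_ker, LinearMap.comp_apply, map_sub, map_sub, hEHE, sub_self]

end QTilt

end
end

section
/- Let I ⊆ X be a closed subset and let M be an object of 𝒳_{I,𝒜} that is free as an 𝒜-module. If there exists a non-degenerate symmetric contravariant form on M, then M is maximal. -/
/-! Common framework for "Quantum tilting modules over local rings" (Fiebig). -/

noncomputable section

open scoped DirectSum

namespace QTilt

variable (R : RootSystemData)

variable (A : Type) [CommRing A]

variable {R A}

/-- an object of `𝒳_{I,𝒜}` that is free as an `𝒜`-module and admits
a non-degenerate symmetric contravariant form is maximal. -/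
theorem statement16 (R : RootSystemData) (A : Type) [CommRing A] [IsDomain A] [IsNoetherianRing A] [Algebra 𝒵 A]
    (I : Set R.X) (hI : RClosed R I) (M : GrObj R A) (hM : IsXObj I M)
    (hfree : ∀ μ, Module.Free A (M.M μ))
    (b : ∀ μ, M.M μ →ₗ[A] M.M μ →ₗ[A] A)
    (hb : IsContraForm I M b) (hnd : NondegOn I b) :
    MaximalOn I M := by
  classical
  obtain ⟨-, -, -, -, h3b, h3c⟩ := hM
  intro μ hμ
  have hmem : ∀ (α : R.Pi) (n : ℕ), μ + n • R.root α ∈ I := by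
    intro α n
    refine hI μ hμ _ ⟨Pi.single α n, ?_⟩
    congr 1
    rw [Finset.sum_eq_single α]
    · simp
    · intro β _ hβ
      simp [Pi.single_eq_of_ne hβ]
    · intro h
      exact absurd (Finset.mem_univ α) h
  ext m
  constructor
  · rintro ⟨ξ, hξ, x, hx, hxm⟩
    have hcomp : ∀ p : R.Pi × {n : ℕ // 0 < n},
        M.E μ p.1 (p.2 : ℕ) x = ξ • m p := fun p => congrFun hxm p
    have hF : ∀ (p : R.Pi × {n : ℕ // 0 < n}) (y : M.M (μ + (p.2 : ℕ) • R.root p.1)),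
        b μ x (M.F μ p.1 p.2 y) = ξ * b _ (m p) y := by
      intro p y
      rw [← hb.2 μ hμ p.1 p.2 p.2.2 x y, hcomp p]
      simp
    have hle : imF M μ ≤ Submodule.comap (b μ x) (Ideal.span {ξ}) := by
      refine iSup_le ?_
      rintro p _ ⟨y, rfl⟩
      change b μ x (M.F μ p.1 p.2 y) ∈ Ideal.span {ξ}
      rw [hF p y]
      exact Ideal.mem_span_singleton.2 (dvd_mul_right _ _)
    have hdiv : ∀ u : imF M μ, ∃ a : A, b μ x u = ξ * a := fun u =>
      Ideal.mem_span_singleton.1 (hle u.2)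
    choose φ hφ using hdiv
    let Φ : imF M μ →ₗ[A] A :=
      { toFun := φ
        map_add' := fun u v => by
          apply mul_left_cancel₀ hξ
          rw [mul_add, ← hφ, ← hφ, ← hφ]
          simp
        map_smul' := fun a u => by
          apply mul_left_cancel₀ hξ
          rw [← hφ, RingHom.id_apply, smul_eq_mul, mul_left_comm, ← hφ]
          simp }
    have := h3c μ hμ
    obtain ⟨s, hs⟩ := Module.projective_lifting_property (imF M μ).mkQ
      (LinearMap.id : (M.M μ ⧸ imF M μ) →ₗ[A] _) (Submodule.mkQ_surjective _)
    let P : M.M μ →ₗ[A] imF M μ :=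
      LinearMap.codRestrict (imF M μ) (LinearMap.id - s.comp (imF M μ).mkQ) (fun u => by
        refine (Submodule.Quotient.mk_eq_zero (imF M μ)).1 ?_
        rw [← Submodule.mkQ_apply]
        have := LinearMap.congr_fun hs ((imF M μ).mkQ u)
        simp only [LinearMap.comp_apply, LinearMap.id_apply] at this
        simp only [LinearMap.sub_apply, LinearMap.comp_apply, LinearMap.id_apply, map_sub, this,
          sub_self])
    have hP : ∀ u : imF M μ, P u = u := by
      intro u
      apply Subtype.ext
      have h0 : (imF M μ).mkQ (u : M.M μ) = 0 := by simp
      change (u : M.M μ) - s ((imF M μ).mkQ u) = u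
      rw [h0, map_zero, sub_zero]
    obtain ⟨z, hz⟩ := (hnd μ hμ).2 (Φ.comp P)
    refine ⟨z, ?_⟩
    funext p
    apply (hnd _ (hmem p.1 p.2)).1
    ext y
    change b _ (M.E μ p.1 p.2 z) y = _
    rw [hb.2 μ hμ p.1 p.2 p.2.2 z y, hz]
    apply mul_left_cancel₀ hξ
    rw [← hF p y]
    have h1 := hP ⟨_, mem_imF M μ p.1 p.2.2 y⟩
    rw [LinearMap.comp_apply, h1]
    exact (hφ _).symm
  · rintro ⟨x, rfl⟩
    exact h3b μ hμ x

end QTilt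

end
end
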